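/- arXiv:1408.6710 — 2 statements merged into one kernel-verified Lean document; each statement's English description precedes it below -/
import Mathlib

section
/- Let X be a preconnected topological space. Then the following are equivalent: (1) every continuous function j : X → ℝ is bounded (there exists M such that |j(x)| ≤ M for all x in X); (2) the map from the empty space to X has the lifting property with respect to the canonical map from the disjoint union over n ∈ ℕ of the open intervals (-n, n) to ℝ; concretely, for every continuous j : X → ℝ there exists a continuous map h from X to the topological disjoint union Σ (n : ℕ), Ioo (-(n : ℝ)) (n : ℝ) such that composing h with the canonical map (n, t) ↦ t recovers j. -/
/-- For a preconnected space `X`: every continuous real-valued function on `X`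
is bounded iff the map `∅ → X` has the lifting property w.r.t. the canonical
map `⨆ₙ (-n, n) → ℝ`: every continuous `j : X → ℝ` lifts to a continuous map
into the disjoint union of the open intervals `(-n, n)`. -/
theorem bounded_iff_lifting {X : Type*} [TopologicalSpace X]
    [PreconnectedSpace X] :
    (∀ j : X → ℝ, Continuous j → ∃ M : ℝ, ∀ x : X, |j x| ≤ M) ↔
      (∀ j : X → ℝ, Continuous j →
        ∃ h : X → Σ n : ℕ, Set.Ioo (-(n : ℝ)) (n : ℝ),
          Continuous h ∧ (fun x => ((h x).2 : ℝ)) = j) := by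
  constructor
  · intro hb j hj
    obtain ⟨M, hM⟩ := hb j hj
    obtain ⟨n, hn⟩ := exists_nat_gt M
    have hmem (x : X) : j x ∈ Set.Ioo (-(n : ℝ)) (n : ℝ) :=
      abs_lt.mp ((hM x).trans_lt hn)
    exact ⟨fun x => ⟨n, j x, hmem x⟩, continuous_sigmaMk.comp (hj.subtype_mk hmem), rfl⟩
  · intro hl j hj
    obtain ⟨h, hh, rfl⟩ := hl j hj
    cases isEmpty_or_nonempty X with
    | inl hX => exact ⟨0, fun x => (hX.false x).elim⟩
    | inr hX =>
      have : ConnectedSpace X := ⟨hX⟩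
      obtain ⟨n, g, -, rfl⟩ := hh.exists_lift_sigma
      exact ⟨n, fun x => (abs_lt.mpr (g x).2).le⟩
end

section
/- Let W be the three-point topological space on Fin 3 whose open sets are generated by {0} and {2} (so the open sets are ∅, {0}, {2}, {0,2}, and W; the point 1 is closed). A topological space X is Hausdorff if and only if for every pair of distinct points x ≠ x' in X, every injective map from the two-point discrete space into X sending the two points to x and x' has the lifting property with respect to the map from W to a one-point space; concretely, if and only if for all x ≠ x' in X and all points w, w' of W there exists a continuous map h : X → W with h(x) = w and h(x') = w'. -/
open Topology

/-- The three-point space `W` on `Fin 3` whose topology is generated by the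
open sets `{0}` and `{2}` (so `1` is a closed point). -/
def Wtop : TopologicalSpace (Fin 3) :=
  TopologicalSpace.generateFrom {{0}, {2}}

/-- A map into `W` is continuous iff the fibres over the two open points are open. -/
theorem continuous_Wtop_iff {X : Type*} [t : TopologicalSpace X] {h : X → Fin 3} :
    Continuous[t, Wtop] h ↔ IsOpen (h ⁻¹' {0}) ∧ IsOpen (h ⁻¹' {2}) :=
  continuous_generateFrom_iff.trans (by simp)

/-- A topological space `X` is Hausdorff iff for every pair of distinct points
`x ≠ x'`, every injective map from the two-point discrete space to `X` with
image `{x, x'}` has the lifting property w.r.t. `W → {•}`: for all `w, w' : W`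
there is a continuous `h : X → W` with `h x = w` and `h x' = w'`. -/
theorem t2_iff_lifting_W {X : Type*} [TopologicalSpace X] :
    T2Space X ↔
      ∀ x x' : X, x ≠ x' → ∀ w w' : Fin 3,
        ∃ h : X → Fin 3,
          Continuous[‹TopologicalSpace X›, Wtop] h ∧ h x = w ∧ h x' = w' := by
  constructor
  · intro _ x x' hne w w'
    obtain ⟨U, V, hU, hV, hxU, hxV, hd⟩ := t2_separation hne
    have hxU' : x' ∉ U := fun hx => Set.disjoint_left.mp hd hx hxV
    classical
    let h : X → Fin 3 := fun y => if y ∈ U then w else if y ∈ V then w' else 1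
    have fibre_isOpen (a : Fin 3) (ha : a ≠ 1) : IsOpen (h ⁻¹' {a}) := by
      have fibre_eq : h ⁻¹' {a} = {y | y ∈ U ∧ w = a} ∪ {y | y ∈ V ∧ w' = a} := by
        ext y
        have hy : y ∈ U → y ∉ V := fun hyU => Set.disjoint_left.mp hd hyU
        by_cases hyU : y ∈ U <;> by_cases hyV : y ∈ V <;> simp_all [h, ha.symm]
      rw [fibre_eq]
      exact (hU.and isOpen_const).union (hV.and isOpen_const)
    exact ⟨h, continuous_Wtop_iff.mpr
      ⟨fibre_isOpen 0 (by decide), fibre_isOpen 2 (by decide)⟩,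
      by simp [h, hxU], by simp [h, hxU', hxV]⟩
  · refine fun H => ⟨fun x x' hne => ?_⟩
    obtain ⟨h, hc, hx, hx'⟩ := H x x' hne 0 2
    obtain ⟨h₀, h₂⟩ := continuous_Wtop_iff.mp hc
    exact ⟨_, _, h₀, h₂, hx, hx', Disjoint.preimage h (by simp)⟩
end
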